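/- Let X be a nonempty set and let d : X² → ℝ be a pseudometric. Then d is strongly rigid if and only if P_{d⁻¹} = P ⊗ P_S^1 holds, where P is the partition of X corresponding to the equivalence relation ≎₀ generated by d (i.e., the partition of X into the equivalence classes of ≎₀). -/

import Mathlib

open Set

universe u v w z

def range2 {X : Type u} {A : Type w} (Φ : X → X → A) : Set A := {a | ∃ x y, Φ x y = a}

def fiber {X : Type u} {A : Type w} (Φ : X → X → A) (a : A) : Set (X × X) :=
  {p | Φ p.1 p.2 = a}

def fibers {X : Type u} {A : Type w} (Φ : X → X → A) : Set (Set (X × X)) :=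
  {R | ∃ a ∈ range2 Φ, R = fiber Φ a}

def IsCoherent {X : Type u} {A : Type w} (Φ : X → X → A) (a₀ : A) : Prop :=
  Equivalence (fun x y => Φ x y = a₀) ∧
    ∀ x₁ x₂ x₃ x₄, Φ x₁ x₂ = a₀ → Φ x₃ x₄ = a₀ → Φ x₁ x₃ = Φ x₂ x₄

def CombSim {X : Type u} {Y : Type v} {A : Type w} {B : Type z}
    (Φ : X → X → A) (Ψ : Y → Y → B) : Prop :=
  ∃ (g : Y → X) (f : A → B), Function.Bijective g ∧
    Set.BijOn f (range2 Φ) (range2 Ψ) ∧ ∀ x y, Ψ x y = f (Φ (g x) (g y))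

def IsPseudometric {X : Type u} (d : X → X → ℝ) : Prop :=
  (∀ x y, 0 ≤ d x y) ∧ (∀ x y, d x y = d y x) ∧ (∀ x, d x x = 0) ∧
    ∀ x y z, d x y ≤ d x z + d z y

def IsStronglyRigid {X : Type u} (d : X → X → ℝ) : Prop :=
  ∀ x y uu vv, d x y = d uu vv → d x y ≠ 0 →
    (d x uu = 0 ∧ d y vv = 0) ∨ (d x vv = 0 ∧ d y uu = 0)

/-- The partition `P ⊗ P_S^1` of `X²` associated with a partition `P` of `X`. -/
def tensorPS1 {X : Type u} (P : Set (Set X)) : Set (Set (X × X)) :=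
  {B | B = (⋃ C ∈ P, C ×ˢ C) ∨
    ∃ C₁ ∈ P, ∃ C₂ ∈ P, C₁ ≠ C₂ ∧ B = (C₁ ×ˢ C₂) ∪ (C₂ ×ˢ C₁)}

namespace IsPseudometric

variable {X : Type u} {d : X → X → ℝ}

theorem eq_zero_trans (hd : IsPseudometric d) {x y z : X} (hxy : d x y = 0) (hyz : d y z = 0) :
    d x z = 0 := by
  linarith [hd.1 x z, hd.2.2.2 x z y]

theorem eq_zero_symm (hd : IsPseudometric d) {x y : X} (h : d x y = 0) : d y x = 0 :=
  (hd.2.1 y x).trans h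

theorem dist_congr (hd : IsPseudometric d) {x y u v : X} (hxu : d x u = 0) (hyv : d y v = 0) :
    d x y = d u v := by
  linarith [hd.2.2.2 x y u, hd.2.2.2 u y v, hd.2.2.2 u v x, hd.2.2.2 x v y,
    hd.2.1 u x, hd.2.1 v y]

theorem zeroClass_eq_iff (hd : IsPseudometric d) {x y : X} :
    {z | d x z = 0} = {z | d y z = 0} ↔ d x y = 0 := by
  constructor
  · intro h
    have hy : y ∈ {z | d y z = 0} := hd.2.2.1 y
    rwa [← h] at hy
  · intro h
    ext z
    exact ⟨hd.eq_zero_trans (hd.eq_zero_symm h), hd.eq_zero_trans h⟩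

theorem iUnion_zeroClass_prod_self (hd : IsPseudometric d) :
    (⋃ C ∈ {B : Set X | ∃ x, B = {y | d x y = 0}}, C ×ˢ C) = fiber d 0 := by
  ext ⟨p, q⟩
  simp only [mem_iUnion, exists_prop, mem_ofPred_eq, mem_prod, fiber]
  constructor
  · rintro ⟨_, ⟨x, rfl⟩, hp, hq⟩
    exact hd.eq_zero_trans (hd.eq_zero_symm hp) hq
  · exact fun h => ⟨_, ⟨p, rfl⟩, hd.2.2.1 p, h⟩

theorem fiber_eq_of_stronglyRigid (hd : IsPseudometric d) (h : IsStronglyRigid d) {x y : X}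
    (hxy : d x y ≠ 0) :
    fiber d (d x y) =
      ({z | d x z = 0} ×ˢ {z | d y z = 0}) ∪ ({z | d y z = 0} ×ˢ {z | d x z = 0}) := by
  ext ⟨p, q⟩
  simp only [fiber, mem_union, mem_prod, mem_ofPred_eq]
  constructor
  · intro hpq
    exact (h x y p q hpq.symm hxy).imp_right And.symm
  · rintro (⟨hp, hq⟩ | ⟨hp, hq⟩)
    · exact (hd.dist_congr hp hq).symm
    · exact (hd.dist_congr hp hq).symm.trans (hd.2.1 y x)

end IsPseudometric

/-- Corollary 4.13: a pseudometric `d` on a nonempty set `X` is strongly rigid iff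
`P_{d⁻¹} = P ⊗ P_S^1`, where `P` is the partition of `X` into the equivalence classes
of the relation `d(x,y) = 0`. -/
theorem stronglyRigid_iff_fibers_eq_tensor {X : Type u} [Nonempty X]
    (d : X → X → ℝ) (hd : IsPseudometric d) :
    IsStronglyRigid d ↔
      fibers d = tensorPS1 {B : Set X | ∃ x, B = {y | d x y = 0}} := by
  constructor
  · intro h
    ext R
    constructor
    · rintro ⟨_, ⟨x, y, rfl⟩, rfl⟩
      by_cases hxy : d x y = 0
      · left
        rw [hd.iUnion_zeroClass_prod_self, hxy]
      · exact Or.inr ⟨_, ⟨x, rfl⟩, _, ⟨y, rfl⟩, hd.zeroClass_eq_iff.not.mpr hxy,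
          hd.fiber_eq_of_stronglyRigid h hxy⟩
    · rintro (rfl | ⟨_, ⟨x, rfl⟩, _, ⟨y, rfl⟩, hne, rfl⟩)
      · obtain ⟨x⟩ := ‹Nonempty X›
        exact ⟨0, ⟨x, x, hd.2.2.1 x⟩, hd.iUnion_zeroClass_prod_self⟩
      · exact ⟨d x y, ⟨x, y, rfl⟩,
          (hd.fiber_eq_of_stronglyRigid h (hd.zeroClass_eq_iff.not.mp hne)).symm⟩
  · intro h x y p q hpq hxy
    have hmem : fiber d (d x y) ∈ fibers d := ⟨_, ⟨x, y, rfl⟩, rfl⟩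
    have hx : (x, y) ∈ fiber d (d x y) := rfl
    have hp : (p, q) ∈ fiber d (d x y) := hpq.symm
    rw [h] at hmem
    obtain hR | ⟨_, ⟨a, rfl⟩, _, ⟨b, rfl⟩, -, hR⟩ := hmem
    · rw [hR, hd.iUnion_zeroClass_prod_self] at hx
      exact absurd hx hxy
    · rw [hR] at hx hp
      have key {c s t : X} (hs : d c s = 0) (ht : d c t = 0) : d s t = 0 :=
        hd.eq_zero_trans (hd.eq_zero_symm hs) ht
      obtain ⟨hx, hy⟩ | ⟨hx, hy⟩ := hx <;> obtain ⟨hp, hq⟩ | ⟨hp, hq⟩ := hp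
      · exact Or.inl ⟨key hx hp, key hy hq⟩
      · exact Or.inr ⟨key hx hq, key hy hp⟩
      · exact Or.inr ⟨key hx hq, key hy hp⟩
      · exact Or.inl ⟨key hx hp, key hy hq⟩
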